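/- The variety X = {(A, z) ∈ 𝔰𝔩₃ × ℙ² : A is nilpotent of rank ≤ 1 lying in the closure of the minimal nilpotent orbit, A·z = 0, A ≠ 0 on the dense stratum}, with SL₃ acting by (g·A, g·z) = (gAg⁻¹, gz), has a dense SL₃-orbit whose complement is a single closed SL₃-orbit. -/

import Mathlib

/- STATEMENT 16: The variety X = {(A, z) ∈ ℙ(𝔤𝔩₃) × ℙ² : A nilpotent of rank ≤ 1 (i.e.
A² = 0, A traceless, A ≠ 0), A·z = 0}, with SL₃ acting by (g·A, g·z) = (gAg⁻¹, gz), has a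
dense SL₃-orbit whose complement in X is a single closed SL₃-orbit (closed in X).  This is
the cuspidal two-orbit variety of type II for A₂.  The A-coordinate is projectivized so
that X is projective. -/

open Matrix

abbrev M3 := Matrix (Fin 3) (Fin 3) ℂ
abbrev SL3 := Matrix.SpecialLinearGroup (Fin 3) ℂ

noncomputable instance projectivizationTopology (V : Type*) [AddCommGroup V] [Module ℂ V]
    [TopologicalSpace V] : TopologicalSpace (Projectivization ℂ V) :=
  instTopologicalSpaceQuotient

/-- Conjugation by g ∈ SL₃ as a linear map on 𝔤𝔩₃. -/
noncomputable def conjLM3 (g : SL3) : M3 →ₗ[ℂ] M3 :=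
  (LinearMap.mulRight ℂ ((g⁻¹ : SL3) : M3)).comp (LinearMap.mulLeft ℂ (g : M3))

lemma conjLM3_injective (g : SL3) : Function.Injective (conjLM3 g) := by
  intro A B h
  have key : ((g⁻¹ : SL3) : M3) * g = 1 := by
    rw [← Matrix.SpecialLinearGroup.coe_mul, inv_mul_cancel, Matrix.SpecialLinearGroup.coe_one]
  have h1 : (g : M3) * A * ((g⁻¹ : SL3) : M3) = (g : M3) * B * ((g⁻¹ : SL3) : M3) := h
  have recov : ∀ C : M3, ((g⁻¹ : SL3) : M3) * ((g : M3) * C * ((g⁻¹ : SL3) : M3)) * (g : M3)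
      = C := by
    intro C
    simp only [← mul_assoc]
    rw [key, one_mul, mul_assoc, key, mul_one]
  calc A = ((g⁻¹ : SL3) : M3) * ((g : M3) * A * ((g⁻¹ : SL3) : M3)) * (g : M3) :=
        (recov A).symm
    _ = ((g⁻¹ : SL3) : M3) * ((g : M3) * B * ((g⁻¹ : SL3) : M3)) * (g : M3) := by rw [h1]
    _ = B := recov B

/-- The SL₃-action on ℙ(𝔤𝔩₃) × ℙ². -/
noncomputable def act16 (g : SL3) :
    Projectivization ℂ M3 × Projectivization ℂ (Fin 3 → ℂ) →
    Projectivization ℂ M3 × Projectivization ℂ (Fin 3 → ℂ) :=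
  fun p =>
    (Projectivization.map (conjLM3 g) (conjLM3_injective g) p.1,
     Projectivization.map (Matrix.SpecialLinearGroup.toLin' g).toLinearMap
       (Matrix.SpecialLinearGroup.toLin' g).injective p.2)

/-- The variety of pairs ([A], [z]) with A ≠ 0 nilpotent of rank ≤ 1 and Az = 0. -/
noncomputable def X16 :
    Set (Projectivization ℂ M3 × Projectivization ℂ (Fin 3 → ℂ)) :=
  {p | ∃ (A : M3) (hA : A ≠ 0) (v : Fin 3 → ℂ) (hv : v ≠ 0),
    p.1 = Projectivization.mk ℂ A hA ∧ p.2 = Projectivization.mk ℂ v hv ∧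
    A.trace = 0 ∧ A * A = 0 ∧ A.mulVec v = 0}

lemma mk_isOpenQuotientMap (V : Type*) [AddCommGroup V] [Module ℂ V]
    [TopologicalSpace V] [ContinuousConstSMul ℂ V] :
    IsOpenQuotientMap (Projectivization.mk' ℂ : {v : V // v ≠ 0} → Projectivization ℂ V) := by
  have hq : Topology.IsQuotientMap
      (Projectivization.mk' ℂ : {v : V // v ≠ 0} → Projectivization ℂ V) :=
    isQuotientMap_quot_mk
  refine ⟨hq.surjective, hq.continuous, ?_⟩
  intro U hU
  rw [← hq.isOpen_preimage]
  have hsm : ∀ c : ℂˣ, Continuous (fun v : {v : V // v ≠ 0} =>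
      (⟨(c : ℂ) • (v : V), smul_ne_zero c.ne_zero v.2⟩ : {v : V // v ≠ 0})) := by
    intro c
    exact Continuous.subtype_mk (continuous_subtype_val.const_smul _) _
  have : (Projectivization.mk' ℂ : {v : V // v ≠ 0} → Projectivization ℂ V) ⁻¹'
      ((Projectivization.mk' ℂ) '' U) = ⋃ c : ℂˣ, (fun v : {v : V // v ≠ 0} =>
      (⟨(c : ℂ) • (v : V), smul_ne_zero c.ne_zero v.2⟩ : {v : V // v ≠ 0})) ⁻¹' U := by
    ext v
    simp only [Set.mem_preimage, Set.mem_image, Set.mem_iUnion]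
    constructor
    · rintro ⟨u, hu, h⟩
      rw [Projectivization.mk'_eq_mk, Projectivization.mk'_eq_mk,
        Projectivization.mk_eq_mk_iff] at h
      obtain ⟨c, hc⟩ := h
      refine ⟨c, ?_⟩
      have he : (⟨(c : ℂ) • (v : V), smul_ne_zero c.ne_zero v.2⟩ : {v : V // v ≠ 0}) = u :=
        Subtype.ext hc
      exact he ▸ hu
    · rintro ⟨c, hc⟩
      refine ⟨_, hc, ?_⟩
      rw [Projectivization.mk'_eq_mk, Projectivization.mk'_eq_mk,
        Projectivization.mk_eq_mk_iff]
      exact ⟨c, rfl⟩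
  rw [this]
  exact isOpen_iUnion fun c => hU.preimage (hsm c)

/-- The closed incidence condition: the range of `A` is contained in the line of `v`. -/
def incid : Set (Projectivization ℂ M3 × Projectivization ℂ (Fin 3 → ℂ)) :=
  {P | ∀ (A : M3) (hA : A ≠ 0) (v : Fin 3 → ℂ) (hv : v ≠ 0),
    P = (Projectivization.mk ℂ A hA, Projectivization.mk ℂ v hv) →
    ∀ x, crossProduct (A *ᵥ x) v = 0}

lemma mk_mem_incid (A : M3) (hA : A ≠ 0) (v : Fin 3 → ℂ) (hv : v ≠ 0) :
    (Projectivization.mk ℂ A hA, Projectivization.mk ℂ v hv) ∈ incid ↔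
      ∀ x, crossProduct (A *ᵥ x) v = 0 := by
  constructor
  · intro h
    exact h A hA v hv rfl
  · intro h B hB w hw e x
    rw [Prod.mk.injEq, Projectivization.mk_eq_mk_iff', Projectivization.mk_eq_mk_iff'] at e
    obtain ⟨⟨a, ha⟩, ⟨b, hb⟩⟩ := e
    have ha0 : a ≠ 0 := by rintro rfl; exact hA (by rw [← ha, zero_smul])
    have hb0 : b ≠ 0 := by rintro rfl; exact hv (by rw [← hb, zero_smul])
    have := h x
    rw [← ha, ← hb, Matrix.smul_mulVec, map_smul, map_smul, LinearMap.smul_apply] at this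
    simpa [ha0, hb0] using this

lemma incid_closed : IsClosed incid := by
  have hq := ((mk_isOpenQuotientMap M3).prodMap
    (mk_isOpenQuotientMap (Fin 3 → ℂ))).isQuotientMap
  rw [← hq.isClosed_preimage]
  have : (Prod.map (Projectivization.mk' ℂ) (Projectivization.mk' ℂ) ⁻¹' incid) =
      {P : {v : M3 // v ≠ 0} × {v : Fin 3 → ℂ // v ≠ 0} |
        ∀ x, crossProduct (P.1.1 *ᵥ x) P.2.1 = 0} := by
    ext ⟨A, v⟩
    exact mk_mem_incid A.1 A.2 v.1 v.2
  rw [this, Set.ofPred_forall]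
  refine isClosed_iInter fun x => isClosed_eq ?_ continuous_const
  have h1 : Continuous (fun P : {v : M3 // v ≠ 0} × {v : Fin 3 → ℂ // v ≠ 0} =>
      P.1.1 *ᵥ x) :=
    Continuous.matrix_mulVec (continuous_subtype_val.comp continuous_fst) continuous_const
  have h2 : Continuous (fun P : {v : M3 // v ≠ 0} × {v : Fin 3 → ℂ // v ≠ 0} => P.2.1) :=
    continuous_subtype_val.comp continuous_snd
  have h1i := fun i => (continuous_apply i).comp h1
  have h2i := fun i => (continuous_apply i).comp h2
  simp only [cross_apply]
  refine continuous_pi fun i => ?_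
  fin_cases i
  · exact ((h1i 1).mul (h2i 2)).sub ((h1i 2).mul (h2i 1))
  · exact ((h1i 2).mul (h2i 0)).sub ((h1i 0).mul (h2i 2))
  · exact ((h1i 0).mul (h2i 1)).sub ((h1i 1).mul (h2i 0))

lemma rank_one (A : M3) (hA : A ≠ 0) (ht : A.trace = 0) (h2 : A * A = 0) :
    ∃ u w : Fin 3 → ℂ, u ≠ 0 ∧ w ≠ 0 ∧ w ⬝ᵥ u = 0 ∧ A = vecMulVec u w := by
  have hle : LinearMap.range A.mulVecLin ≤ LinearMap.ker A.mulVecLin := by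
    rintro _ ⟨x, rfl⟩
    simp [Matrix.mulVec_mulVec, h2]
  have h3 := LinearMap.finrank_range_add_finrank_ker A.mulVecLin
  have h4 := Submodule.finrank_mono hle
  simp only [Module.finrank_fin_fun] at h3
  have h5 : Module.finrank ℂ (LinearMap.range A.mulVecLin) ≤ 1 := by omega
  rw [finrank_le_one_iff] at h5
  obtain ⟨u, hu⟩ := h5
  have : ∀ j, ∃ c : ℂ, c • (u : Fin 3 → ℂ) = A.col j := by
    intro j
    obtain ⟨c, hc⟩ := hu ⟨A.mulVecLin (Pi.single j 1), ⟨_, rfl⟩⟩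
    refine ⟨c, ?_⟩
    have := congrArg Subtype.val hc
    simpa using this
  choose w hw using this
  have hAe : A = vecMulVec u.1 w := by
    ext i j
    have := congrFun (hw j) i
    simp only [Pi.smul_apply, smul_eq_mul, Matrix.col_apply] at this
    rw [vecMulVec_apply, ← this, mul_comm]
  refine ⟨u.1, w, ?_, ?_, ?_, hAe⟩
  · intro h
    apply hA
    rw [hAe, h]
    simp
  · rintro rfl
    apply hA
    rw [hAe]
    simp
  · rw [hAe, Matrix.trace_vecMulVec] at ht
    rw [dotProduct_comm]
    exact ht

lemma act_mk (g : SL3) (A : M3) (hA : A ≠ 0) (v : Fin 3 → ℂ) (hv : v ≠ 0)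
    (B : M3) (hB : B ≠ 0) (w : Fin 3 → ℂ) (hw : w ≠ 0) (a b : ℂ)
    (h1 : B * (g : M3) = a • ((g : M3) * A)) (h2 : w = b • ((g : M3) *ᵥ v)) :
    (Projectivization.mk ℂ B hB, Projectivization.mk ℂ w hw) =
      act16 g (Projectivization.mk ℂ A hA, Projectivization.mk ℂ v hv) := by
  have key : (g : M3) * ((g⁻¹ : SL3) : M3) = 1 := by
    rw [← Matrix.SpecialLinearGroup.coe_mul, mul_inv_cancel, Matrix.SpecialLinearGroup.coe_one]
  unfold act16
  simp only [Projectivization.map_mk]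
  rw [Prod.mk.injEq, Projectivization.mk_eq_mk_iff', Projectivization.mk_eq_mk_iff']
  constructor
  · refine ⟨a, ?_⟩
    have : B = B * (g : M3) * ((g⁻¹ : SL3) : M3) := by rw [mul_assoc, key, mul_one]
    rw [this, h1, Matrix.smul_mul]
    rfl
  · exact ⟨b, h2.symm⟩

lemma act_mk_self (g : SL3) (A : M3) (hA : A ≠ 0) (v : Fin 3 → ℂ) (hv : v ≠ 0) :
    ∃ (B : M3) (hB : B ≠ 0) (w : Fin 3 → ℂ) (hw : w ≠ 0),
      B = (g : M3) * A * ((g⁻¹ : SL3) : M3) ∧ w = (g : M3) *ᵥ v ∧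
      act16 g (Projectivization.mk ℂ A hA, Projectivization.mk ℂ v hv) =
        (Projectivization.mk ℂ B hB, Projectivization.mk ℂ w hw) :=
  ⟨conjLM3 g A, fun h => hA (conjLM3_injective g (by rw [h, map_zero])),
    Matrix.SpecialLinearGroup.toLin' g v,
    fun h => hv ((Matrix.SpecialLinearGroup.toLin' g).injective (by rw [h, map_zero])),
    rfl, rfl, rfl⟩

lemma act_X16 (g : SL3) (P) (hP : P ∈ X16) : act16 g P ∈ X16 := by
  obtain ⟨A, hA, v, hv, e1, e2, ht, hs, hk⟩ := hP
  obtain rfl : P = (Projectivization.mk ℂ A hA, Projectivization.mk ℂ v hv) := Prod.ext e1 e2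
  obtain ⟨B, hB, w, hw, eB, ew, e⟩ := act_mk_self g A hA v hv
  have key : ((g⁻¹ : SL3) : M3) * g = 1 := by
    rw [← Matrix.SpecialLinearGroup.coe_mul, inv_mul_cancel, Matrix.SpecialLinearGroup.coe_one]
  refine ⟨B, hB, w, hw, by rw [e], by rw [e], ?_, ?_, ?_⟩
  · rw [eB, Matrix.trace_mul_comm, ← mul_assoc, key, one_mul, ht]
  · rw [eB]
    calc (g : M3) * A * ((g⁻¹ : SL3) : M3) * ((g : M3) * A * ((g⁻¹ : SL3) : M3))
        = (g : M3) * A * (((g⁻¹ : SL3) : M3) * g) * A * ((g⁻¹ : SL3) : M3) := by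
          simp only [mul_assoc]
      _ = (g : M3) * (A * A) * ((g⁻¹ : SL3) : M3) := by
          rw [key, mul_one, mul_assoc (g : M3)]
      _ = 0 := by rw [hs]; simp
  · rw [eB, ew, Matrix.mulVec_mulVec, mul_assoc, mul_assoc, key, mul_one,
      ← Matrix.mulVec_mulVec, hk, Matrix.mulVec_zero]

/-- The base matrix `E₀₂`. -/
def E02 : M3 := !![0, 0, 1; 0, 0, 0; 0, 0, 0]

lemma E02_ne : E02 ≠ 0 := by
  intro h
  have := congrFun (congrFun h 0) 2
  simp [E02] at this

lemma e1_ne : (![0, 1, 0] : Fin 3 → ℂ) ≠ 0 := by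
  intro h
  have := congrFun h 1
  simp at this

lemma e0_ne : (![1, 0, 0] : Fin 3 → ℂ) ≠ 0 := by
  intro h
  have := congrFun h 0
  simp at this

/-- Base point of the open orbit. -/
noncomputable def bp : Projectivization ℂ M3 × Projectivization ℂ (Fin 3 → ℂ) :=
  (Projectivization.mk ℂ E02 E02_ne, Projectivization.mk ℂ _ e1_ne)

/-- Base point of the closed orbit. -/
noncomputable def bq : Projectivization ℂ M3 × Projectivization ℂ (Fin 3 → ℂ) :=
  (Projectivization.mk ℂ E02 E02_ne, Projectivization.mk ℂ _ e0_ne)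

lemma bp_mem : bp ∈ X16 :=
  ⟨E02, E02_ne, _, e1_ne, rfl, rfl, by simp [E02, Matrix.trace_fin_three],
    by simp [E02, ← Matrix.ext_iff, Fin.forall_fin_succ], by
      ext i; fin_cases i <;> simp [E02, Matrix.mulVec, dotProduct, Fin.sum_univ_three]⟩

lemma bq_mem : bq ∈ X16 :=
  ⟨E02, E02_ne, _, e0_ne, rfl, rfl, by simp [E02, Matrix.trace_fin_three],
    by simp [E02, ← Matrix.ext_iff, Fin.forall_fin_succ], by
      ext i; fin_cases i <;> simp [E02, Matrix.mulVec, dotProduct, Fin.sum_univ_three]⟩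

/-- Transitivity: a frame `u, v` with `w = l • (u × v)` gives `g`. -/
lemma exists_g (u v w : Fin 3 → ℂ) (l : ℂ) (hw : w ≠ 0)
    (h : w = l • crossProduct u v) :
    ∃ g : SL3, vecMulVec u w * (g : M3) = l • ((g : M3) * E02) ∧
      u = (g : M3) *ᵥ ![1, 0, 0] ∧ v = (g : M3) *ᵥ ![0, 1, 0] := by
  have hc : ∃ y : Fin 3 → ℂ, crossProduct u v ⬝ᵥ y = 1 := by
    have hne : crossProduct u v ≠ 0 := by
      intro h0; exact hw (by rw [h, h0, smul_zero])
    obtain ⟨i, hi⟩ := Function.ne_iff.mp hne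
    exact ⟨Pi.single i (crossProduct u v i)⁻¹, by
      rw [dotProduct_single]; exact mul_inv_cancel₀ hi⟩
  obtain ⟨y, hy⟩ := hc
  simp only [cross_apply, dotProduct, Fin.sum_univ_three] at hy
  simp at hy
  refine ⟨⟨!![u 0, v 0, y 0; u 1, v 1, y 1; u 2, v 2, y 2], ?_⟩, ?_, ?_, ?_⟩
  · rw [Matrix.det_fin_three]
    simp
    linear_combination hy
  · subst h
    ext i j
    simp only [cross_apply]
    fin_cases i <;> fin_cases j <;>
      simp [E02, Matrix.mul_apply, Fin.sum_univ_three, vecMulVec_apply]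
    · ring
    · ring
    · linear_combination l * u 0 * hy
    · ring
    · ring
    · linear_combination l * u 1 * hy
    · ring
    · ring
    · linear_combination l * u 2 * hy
  · ext i
    fin_cases i <;> simp [Matrix.mulVec, dotProduct, Fin.sum_univ_three]
  · ext i
    fin_cases i <;> simp [Matrix.mulVec, dotProduct, Fin.sum_univ_three]

open scoped ComplexOrder in
lemma dot_star_ne (u : Fin 3 → ℂ) (hu : u ≠ 0) : u ⬝ᵥ star u ≠ 0 :=
  fun h => hu (dotProduct_self_star_eq_zero.mp h)

lemma exists_frame (u w : Fin 3 → ℂ) (hu : u ≠ 0) (h : w ⬝ᵥ u = 0) :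
    ∃ (v : Fin 3 → ℂ) (l : ℂ), l ≠ 0 ∧ w = l • crossProduct u v := by
  have hs : u ⬝ᵥ star u ≠ 0 := by
    exact dot_star_ne u hu
  refine ⟨crossProduct w (star u), (u ⬝ᵥ star u)⁻¹, inv_ne_zero hs, ?_⟩
  rw [eq_inv_smul_iff₀ hs]
  simp only [dotProduct, Fin.sum_univ_three] at h ⊢
  ext i
  simp only [cross_apply]
  fin_cases i <;> simp
  · linear_combination (starRingEnd ℂ) (u 0) * h
  · linear_combination (starRingEnd ℂ) (u 1) * h
  · linear_combination (starRingEnd ℂ) (u 2) * h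

lemma mem_orbit_p (u v w : Fin 3 → ℂ) (l : ℂ) (hw : w ≠ 0)
    (h : w = l • crossProduct u v) (hA : vecMulVec u w ≠ 0) (hv : v ≠ 0) :
    ∃ g : SL3, (Projectivization.mk ℂ _ hA, Projectivization.mk ℂ v hv) = act16 g bp := by
  obtain ⟨g, h1, h2, h3⟩ := exists_g u v w l hw h
  exact ⟨g, act_mk g _ _ _ _ _ _ _ _ l 1 h1 (by rw [one_smul]; exact h3)⟩

lemma not_incid_p (g : SL3) : act16 g bp ∉ incid := by
  obtain ⟨B, hB, w, hw, eB, ew, e⟩ := act_mk_self g E02 E02_ne _ e1_ne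
  unfold bp
  rw [e, mk_mem_incid]
  intro h
  have key : ((g⁻¹ : SL3) : M3) * g = 1 := by
    rw [← Matrix.SpecialLinearGroup.coe_mul, inv_mul_cancel, Matrix.SpecialLinearGroup.coe_one]
  have := h ((g : M3) *ᵥ ![0, 0, 1])
  rw [eB, ew, Matrix.mulVec_mulVec, mul_assoc, key, mul_one] at this
  have hd := g.2
  rw [Matrix.det_fin_three] at hd
  have h0 := congrFun this 0
  have h1 := congrFun this 1
  have h2 := congrFun this 2
  simp [cross_apply, E02, Matrix.mulVec, dotProduct, Fin.sum_univ_three, Matrix.mul_apply]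
    at h0 h1 h2
  have : (0 : ℂ) = 1 := by
    linear_combination hd - (g : M3) 0 2 * h0 - (g : M3) 1 2 * h1 - (g : M3) 2 2 * h2
  exact zero_ne_one this

lemma incid_q (g : SL3) : act16 g bq ∈ incid := by
  obtain ⟨B, hB, w, hw, eB, ew, e⟩ := act_mk_self g E02 E02_ne _ e0_ne
  unfold bq
  rw [e, mk_mem_incid]
  intro x
  rw [eB, ew, mul_assoc, ← Matrix.mulVec_mulVec, ← Matrix.mulVec_mulVec]
  generalize ((g⁻¹ : SL3) : M3) *ᵥ x = y
  have : E02 *ᵥ y = y 2 • ![1, 0, 0] := by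
    ext i; fin_cases i <;> simp [E02, Matrix.mulVec, dotProduct, Fin.sum_univ_three]
  rw [this, Matrix.mulVec_smul, map_smul, LinearMap.smul_apply, cross_self, smul_zero]

lemma orbit_cases (P) (hP : P ∈ X16) :
    (P ∉ incid ∧ ∃ g : SL3, P = act16 g bp) ∨
    (P ∈ incid ∧ (∃ g : SL3, P = act16 g bq) ∧
      P ∈ closure {r | ∃ g : SL3, r = act16 g bp}) := by
  obtain ⟨A, hA, v, hv, e1, e2, ht, hs, hk⟩ := hP
  obtain rfl : P = (Projectivization.mk ℂ A hA, Projectivization.mk ℂ v hv) := Prod.ext e1 e2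
  obtain ⟨u, w, hu, hw, hwu, rfl⟩ := rank_one A hA ht hs
  have hwv : w ⬝ᵥ v = 0 := by
    rw [Matrix.vecMulVec_mulVec] at hk
    simpa [hu] using hk
  by_cases hc : crossProduct u v = 0
  · right
    have hin : (Projectivization.mk ℂ _ hA, Projectivization.mk ℂ v hv) ∈ incid := by
      rw [mk_mem_incid]
      intro x
      rw [Matrix.vecMulVec_mulVec]
      simp [hc]
    have hvu : ∃ b : ℂ, v = b • u := by
      by_contra hno
      push Not at hno
      apply crossProduct_ne_zero_iff_linearIndependent.mpr _ hc
      rw [LinearIndependent.pair_iff' hu]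
      exact fun a ha => hno a ha.symm
    obtain ⟨b, hb⟩ := hvu
    obtain ⟨v', l, hl, hf⟩ := exists_frame u w hu hwu
    have hcr : crossProduct u v' ≠ 0 := by
      intro h0; exact hw (by rw [hf, h0, smul_zero])
    have hb0 : b ≠ 0 := by rintro rfl; exact hv (by rw [hb, zero_smul])
    refine ⟨hin, ?_, ?_⟩
    · obtain ⟨g, h1, h2, h3⟩ := exists_g u v' w l hw hf
      exact ⟨g, act_mk g _ _ _ _ _ _ _ _ l b h1 (by rw [← h2]; exact hb)⟩
    · have hne : ∀ t : ℂ, v + t • v' ≠ 0 := by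
        intro t h0
        have : crossProduct (v + t • v') v' = 0 := by rw [h0]; simp
        rw [hb] at this
        simp [hcr, hb0] at this
      let f : ℂ → Projectivization ℂ M3 × Projectivization ℂ (Fin 3 → ℂ) := fun t =>
        (Projectivization.mk ℂ _ hA, Projectivization.mk' ℂ ⟨v + t • v', hne t⟩)
      have hfc : Continuous f := by
        refine continuous_const.prodMk ?_
        refine (mk_isOpenQuotientMap (Fin 3 → ℂ)).continuous.comp ?_
        exact Continuous.subtype_mk (by fun_prop) _
      have hf0 : f 0 = (Projectivization.mk ℂ _ hA, Projectivization.mk ℂ v hv) := by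
        simp [f]
      rw [← hf0]
      refine mem_closure_of_tendsto (b := nhdsWithin (0 : ℂ) {0}ᶜ)
        (hfc.continuousAt.tendsto.mono_left nhdsWithin_le_nhds) ?_
      filter_upwards [self_mem_nhdsWithin] with t ht0
      have ht0 : t ≠ 0 := ht0
      refine mem_orbit_p u (v + t • v') w (l / t) hw ?_ hA (hne t)
      rw [map_add, hc, zero_add, map_smul, smul_smul, div_mul_cancel₀ _ ht0, hf]
  · left
    refine ⟨?_, ?_⟩
    · rw [mk_mem_incid]
      intro h
      have := h (star w)
      rw [Matrix.vecMulVec_mulVec] at this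
      have hs : w ⬝ᵥ star w ≠ 0 := by
        exact dot_star_ne w hw
      simp [hc, hs] at this
    · have hl : ∃ a : ℂ, w = a • crossProduct u v := by
        by_contra hno
        push Not at hno
        have h1 : crossProduct (crossProduct u v) w = 0 := by
          rw [cross_cross_eq_smul_sub_smul, dotProduct_comm u w, dotProduct_comm v w, hwu, hwv]
          simp
        apply crossProduct_ne_zero_iff_linearIndependent.mpr _ h1
        rw [LinearIndependent.pair_iff' hc]
        exact fun a ha => hno a ha.symm
      obtain ⟨l, hl⟩ := hl
      exact mem_orbit_p u v w l hw hl hA hv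

theorem nilpotent_pair_variety_two_orbits :
    ∃ p ∈ X16,
      {r | ∃ g : SL3, r = act16 g p} ⊆ X16 ∧
      X16 ⊆ closure {r | ∃ g : SL3, r = act16 g p} ∧
      ∃ q ∈ X16, q ∉ {r | ∃ g : SL3, r = act16 g p} ∧
        X16 \ {r | ∃ g : SL3, r = act16 g p} = {r | ∃ g : SL3, r = act16 g q} ∧
        {r | ∃ g : SL3, r = act16 g q} = X16 ∩ closure {r | ∃ g : SL3, r = act16 g q} := by
  refine ⟨bp, bp_mem, ?_, ?_, bq, bq_mem, ?_, ?_, ?_⟩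
  · rintro _ ⟨g, rfl⟩
    exact act_X16 g _ bp_mem
  · intro P hP
    rcases orbit_cases P hP with ⟨_, h⟩ | ⟨_, _, h⟩
    · exact subset_closure h
    · exact h
  · rintro ⟨g, hg⟩
    have h1 : act16 g bp ∉ incid := not_incid_p g
    rw [← hg] at h1
    apply h1
    unfold bq
    rw [mk_mem_incid]
    intro x
    have : E02 *ᵥ x = x 2 • ![1, 0, 0] := by
      ext i; fin_cases i <;> simp [E02, Matrix.mulVec, dotProduct, Fin.sum_univ_three]
    rw [this, map_smul, LinearMap.smul_apply, cross_self, smul_zero]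
  · ext P
    constructor
    · rintro ⟨hP, hn⟩
      rcases orbit_cases P hP with ⟨_, h⟩ | ⟨_, h, _⟩
      · exact absurd h hn
      · exact h
    · rintro ⟨g, rfl⟩
      refine ⟨act_X16 g _ bq_mem, ?_⟩
      rintro ⟨g', hg'⟩
      have := incid_q g
      rw [hg'] at this
      exact not_incid_p g' this
  · apply Set.Subset.antisymm
    · rintro P hP
      refine ⟨?_, subset_closure hP⟩
      obtain ⟨g, rfl⟩ := hP
      exact act_X16 g _ bq_mem
    · rintro P ⟨hP, hcl⟩
      have hin : P ∈ incid := by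
        refine closure_minimal ?_ incid_closed hcl
        rintro _ ⟨g, rfl⟩
        exact incid_q g
      rcases orbit_cases P hP with ⟨hn, _⟩ | ⟨_, h, _⟩
      · exact absurd hin hn
      · exact h
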